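/- arXiv:2410.19841 — 2 statements merged into one kernel-verified Lean document; each statement's English description precedes it below -/
import Mathlib

section
/- Let n ≥ 1, δ > 0, β < n+2, and set c^{δ,β} = 2(n+2−β)Γ(n/2+1)/(π^{n/2} δ^{n+2−β}). Then (n+2) c^{δ,β} ∫_{B_δ(0)} w_i w_j w_k w_l / ‖w‖^{β+2} dw equals 6 if i=j=k=l; equals 2 if exactly two pairs of indices coincide (i=j≠k=l, or i=k≠j=l, or i=l≠j=k); and equals 0 otherwise. -/
open MeasureTheory

/-- The normalization constant `c^{δ,β}` of the peridynamic kernel. -/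
noncomputable def cdb (n : ℕ) (δ β : ℝ) : ℝ :=
  2 * (n + 2 - β) * Real.Gamma ((n : ℝ) / 2 + 1) /
    (Real.pi ^ ((n : ℝ) / 2) * δ ^ ((n : ℝ) + 2 - β))

section RadialBall

variable {E : Type*} [NormedAddCommGroup E] [InnerProductSpace ℝ E] [FiniteDimensional ℝ E]
  [MeasurableSpace E] [BorelSpace E]

/-- Integrals over a centred ball are invariant under linear isometries. -/
lemma setIntegral_ball_comp_linearIsometryEquiv (e : E ≃ₗᵢ[ℝ] E) (g : E → ℝ) (r : ℝ) :
    ∫ w in Metric.ball (0 : E) r, g (e w) = ∫ w in Metric.ball (0 : E) r, g w := by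
  have h := (LinearIsometryEquiv.measurePreserving e).setIntegral_preimage_emb
    e.toHomeomorph.measurableEmbedding g (Metric.ball (0 : E) r)
  have hs : e ⁻¹' Metric.ball (0 : E) r = Metric.ball 0 r := by
    ext w
    simp
  rwa [hs] at h

/-- The weighted fourth moment in the direction `v` depends only on `‖v‖`. -/
lemma setIntegral_ball_inner_pow_four_eq {u v : E} (h : ‖u‖ = ‖v‖) (r p : ℝ) :
    ∫ w in Metric.ball (0 : E) r, inner ℝ u w ^ 4 / ‖w‖ ^ p =
      ∫ w in Metric.ball (0 : E) r, inner ℝ v w ^ 4 / ‖w‖ ^ p := by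
  rw [← setIntegral_ball_comp_linearIsometryEquiv (Submodule.reflection (ℝ ∙ (u - v))ᗮ)
    (fun w ↦ inner ℝ v w ^ 4 / ‖w‖ ^ p)]
  congr 1 with w
  have hw := LinearIsometryEquiv.inner_map_map (Submodule.reflection (ℝ ∙ (u - v))ᗮ) u w
  rw [Submodule.reflection_sub h] at hw
  rw [LinearIsometryEquiv.norm_map, hw]

/-- The power `‖w‖ ^ q` is integrable near the origin when `q` exceeds minus the dimension. -/
lemma integrableOn_ball_norm_rpow [Nontrivial E] {q : ℝ} (hq : 0 < Module.finrank ℝ E + q)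
    (r : ℝ) : IntegrableOn (fun w : E ↦ ‖w‖ ^ q) (Metric.ball 0 r) := by
  rw [integrableOn_fun_norm_addHaar volume (f := fun y : ℝ ↦ y ^ q)]
  have hd : 1 ≤ Module.finrank ℝ E := Module.finrank_pos
  obtain hr | hr := le_or_gt r 0
  · simp [hr]
  rw [integrableOn_congr_fun (g := fun y : ℝ ↦ y ^ ((Module.finrank ℝ E : ℝ) - 1 + q))
    _ measurableSet_Ioo]
  · rw [intervalIntegral.integrableOn_Ioo_rpow_iff hr]
    linarith
  · intro y hy
    dsimp only
    rw [Real.rpow_add hy.1, smul_eq_mul, ← Real.rpow_natCast, Nat.cast_sub hd, Nat.cast_one]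

/-- The integral of `‖w‖ ^ q` over a centred ball. -/
lemma setIntegral_ball_norm_rpow [Nontrivial E] {q r : ℝ} (hq : 0 < Module.finrank ℝ E + q)
    (hr : 0 < r) :
    ∫ w in Metric.ball (0 : E) r, ‖w‖ ^ q =
      Module.finrank ℝ E * volume.real (Metric.ball (0 : E) 1) *
        (r ^ (Module.finrank ℝ E + q) / (Module.finrank ℝ E + q)) := by
  have hd : 1 ≤ Module.finrank ℝ E := Module.finrank_pos
  have hrad : ∀ w : E, (Metric.ball (0 : E) r).indicator (fun w : E ↦ ‖w‖ ^ q) w =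
      (Set.Iio r).indicator (fun y : ℝ ↦ y ^ q) ‖w‖ := by
    intro w
    simp [Set.indicator]
  rw [← integral_indicator measurableSet_ball, integral_congr_ae (.of_forall hrad),
    integral_fun_norm_addHaar volume, nsmul_eq_mul, smul_eq_mul, ← mul_assoc]
  congr 1
  have hind : ∀ y ∈ Set.Ioi (0 : ℝ),
      y ^ (Module.finrank ℝ E - 1) • (Set.Iio r).indicator (fun y : ℝ ↦ y ^ q) y =
        (Set.Iio r).indicator (fun y ↦ y ^ ((Module.finrank ℝ E : ℝ) - 1 + q)) y := by
    intro y hy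
    by_cases hyr : y < r
    · simp only [Set.indicator, Set.mem_Iio, hyr, if_true]
      rw [Real.rpow_add hy, smul_eq_mul, ← Real.rpow_natCast, Nat.cast_sub hd, Nat.cast_one]
    · simp [hyr]
  rw [setIntegral_congr_fun measurableSet_Ioi hind, setIntegral_indicator measurableSet_Iio,
    Set.Ioi_inter_Iio, ← integral_Ioc_eq_integral_Ioo, ← intervalIntegral.integral_of_le hr.le,
    integral_rpow (.inl (by linarith))]
  have he : (Module.finrank ℝ E : ℝ) - 1 + q + 1 = Module.finrank ℝ E + q := by ring
  rw [he, Real.zero_rpow hq.ne', sub_zero]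

end RadialBall

section FourthMoment

variable {n : ℕ}

/-- The fourth moment of the kernel `‖w‖ ^ (-(β + 2))` over the ball of radius `δ`. -/
noncomputable def fourthMoment (δ β : ℝ) (i j k l : Fin n) : ℝ :=
  ∫ w in Metric.ball (0 : EuclideanSpace ℝ (Fin n)) δ, w i * w j * w k * w l / ‖w‖ ^ (β + 2)

lemma norm_pow_four_div_rpow {E : Type*} [NormedAddCommGroup E] {w : E} (hw : w ≠ 0) (β : ℝ) :
    ‖w‖ ^ 4 / ‖w‖ ^ (β + 2) = ‖w‖ ^ (2 - β) := by
  rw [← Real.rpow_natCast, ← Real.rpow_sub (norm_pos_iff.mpr hw)]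
  congr 1
  push_cast
  ring

lemma integrableOn_fourthMoment {β : ℝ} (hβ : β < n + 2) (δ : ℝ) (i j k l : Fin n) :
    IntegrableOn (fun w : EuclideanSpace ℝ (Fin n) ↦ w i * w j * w k * w l / ‖w‖ ^ (β + 2))
      (Metric.ball 0 δ) := by
  have : Nonempty (Fin n) := ⟨i⟩
  refine (integrableOn_ball_norm_rpow (q := 2 - β) ?_ δ).mono'
    (Measurable.aestronglyMeasurable (by fun_prop)) (.of_forall fun w ↦ ?_)
  · rw [finrank_euclideanSpace_fin]
    linarith
  · obtain rfl | hw := eq_or_ne w 0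
    · simpa using Real.rpow_nonneg le_rfl _
    have h (m : Fin n) : ‖w m‖ ≤ ‖w‖ := PiLp.norm_apply_le w m
    rw [← norm_pow_four_div_rpow hw, norm_div, norm_mul, norm_mul, norm_mul,
      Real.norm_of_nonneg (Real.rpow_nonneg (norm_nonneg w) _)]
    gcongr
    calc ‖w i‖ * ‖w j‖ * ‖w k‖ * ‖w l‖ ≤ ‖w‖ * ‖w‖ * ‖w‖ * ‖w‖ := by gcongr <;> exact h _
      _ = ‖w‖ ^ 4 := by ring

/-- A fourth moment vanishes when one of its indices occurs exactly once. -/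
lemma fourthMoment_eq_zero (δ β : ℝ) {i j k l : Fin n} (hj : j ≠ i) (hk : k ≠ i) (hl : l ≠ i) :
    fourthMoment δ β i j k l = 0 := by
  set e := Submodule.reflection (ℝ ∙ (EuclideanSpace.single i (1 : ℝ)))ᗮ with he
  have hew (w : EuclideanSpace ℝ (Fin n)) :
      e w = w - (2 * w i) • EuclideanSpace.single i (1 : ℝ) := by
    rw [he, Submodule.reflection_orthogonal_apply, Submodule.reflection_singleton_apply]
    simp [EuclideanSpace.inner_single_left, mul_smul, two_smul]
  have h := setIntegral_ball_comp_linearIsometryEquiv e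
    (fun w ↦ w i * w j * w k * w l / ‖w‖ ^ (β + 2)) δ
  have hneg : ∀ w : EuclideanSpace ℝ (Fin n),
      e w i * e w j * e w k * e w l / ‖e w‖ ^ (β + 2) =
        -(w i * w j * w k * w l / ‖w‖ ^ (β + 2)) := by
    intro w
    rw [LinearIsometryEquiv.norm_map, hew]
    simp [hj, hk, hl]
    ring
  simp only [hneg, integral_neg] at h
  unfold fourthMoment
  linarith

lemma fourthMoment_diag_eq_inner (δ β : ℝ) (i : Fin n) :
    fourthMoment δ β i i i i =
      ∫ w in Metric.ball (0 : EuclideanSpace ℝ (Fin n)) δ,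
        inner ℝ (EuclideanSpace.single i (1 : ℝ)) w ^ 4 / ‖w‖ ^ (β + 2) := by
  unfold fourthMoment
  congr 1 with w
  simp only [EuclideanSpace.inner_single_left, map_one, one_mul]
  ring

lemma fourthMoment_diag_eq (δ β : ℝ) (i j : Fin n) :
    fourthMoment δ β i i i i = fourthMoment δ β j j j j := by
  rw [fourthMoment_diag_eq_inner, fourthMoment_diag_eq_inner]
  exact setIntegral_ball_inner_pow_four_eq (by simp) _ _

lemma fourthMoment_diag_eq_three_mul {β : ℝ} (hβ : β < n + 2) (δ : ℝ) {i j : Fin n}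
    (hij : i ≠ j) : fourthMoment δ β i i i i = 3 * fourthMoment δ β i i j j := by
  let a : EuclideanSpace ℝ (Fin n) := EuclideanSpace.single i 1
  let b : EuclideanSpace ℝ (Fin n) := EuclideanSpace.single j 1
  have hab : inner ℝ a b = 0 := by
    simp [a, b, EuclideanSpace.inner_single_left, hij]
  have ha : ‖a‖ = 1 := by simp [a]
  have hb : ‖b‖ = 1 := by simp [b]
  have hs : ‖√2 • a‖ = √2 := by simp [norm_smul, ha]
  have hadd : ‖a + b‖ = ‖√2 • a‖ := by
    rw [hs, eq_comm, Real.sqrt_eq_iff_mul_self_eq (by norm_num) (norm_nonneg _),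
      norm_add_sq_eq_norm_sq_add_norm_sq_real hab, ha, hb]
    norm_num
  have hsub : ‖a - b‖ = ‖√2 • a‖ := by
    rw [hs, eq_comm, Real.sqrt_eq_iff_mul_self_eq (by norm_num) (norm_nonneg _),
      norm_sub_sq_eq_norm_sq_add_norm_sq_real hab, ha, hb]
    norm_num
  have h1 := setIntegral_ball_inner_pow_four_eq hadd δ (β + 2)
  have h2 := setIntegral_ball_inner_pow_four_eq hsub δ (β + 2)
  have hscale : ∫ w in Metric.ball (0 : EuclideanSpace ℝ (Fin n)) δ,
      inner ℝ (√2 • a) w ^ 4 / ‖w‖ ^ (β + 2) = 4 * fourthMoment δ β i i i i := by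
    unfold fourthMoment
    rw [← integral_const_mul]
    congr 1 with w
    have h4 : √2 ^ 4 = (4 : ℝ) := by
      rw [show 4 = 2 * 2 from rfl, pow_mul, Real.sq_sqrt (by norm_num)]
      norm_num
    simp only [a, inner_smul_left, EuclideanSpace.inner_single_left, map_one, one_mul, mul_pow,
      conj_trivial, h4]
    ring
  have hI := integrableOn_fourthMoment hβ δ
  have hexp (s : ℝ) : ∫ w in Metric.ball (0 : EuclideanSpace ℝ (Fin n)) δ,
      inner ℝ (a + s • b) w ^ 4 / ‖w‖ ^ (β + 2) =
        fourthMoment δ β i i i i + 4 * s * fourthMoment δ β i i i j +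
          6 * s ^ 2 * fourthMoment δ β i i j j + 4 * s ^ 3 * fourthMoment δ β i j j j +
          s ^ 4 * fourthMoment δ β j j j j := by
    have c (t : ℝ) (p q r m : Fin n) := (hI p q r m).const_mul t
    have hpt (w : EuclideanSpace ℝ (Fin n)) : inner ℝ (a + s • b) w ^ 4 / ‖w‖ ^ (β + 2) =
        w i * w i * w i * w i / ‖w‖ ^ (β + 2) +
          4 * s * (w i * w i * w i * w j / ‖w‖ ^ (β + 2)) +
          6 * s ^ 2 * (w i * w i * w j * w j / ‖w‖ ^ (β + 2)) +
          4 * s ^ 3 * (w i * w j * w j * w j / ‖w‖ ^ (β + 2)) +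
          s ^ 4 * (w j * w j * w j * w j / ‖w‖ ^ (β + 2)) := by
      simp only [a, b, inner_add_left, inner_smul_left, EuclideanSpace.inner_single_left, map_one,
        one_mul, conj_trivial]
      ring
    have s1 := (hI i i i i).add (c (4 * s) i i i j)
    have s2 := s1.add (c (6 * s ^ 2) i i j j)
    have s3 := s2.add (c (4 * s ^ 3) i j j j)
    simp only [hpt]
    rw [integral_add, integral_add, integral_add, integral_add]
    · simp only [integral_const_mul, fourthMoment]
    exacts [hI _ _ _ _, c _ _ _ _ _, s1, c _ _ _ _ _, s2, c _ _ _ _ _, s3, c _ _ _ _ _]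
  have e1 := hexp 1
  have e2 := hexp (-1)
  rw [one_smul, h1, hscale] at e1
  rw [neg_one_smul, ← sub_eq_add_neg, h2, hscale] at e2
  linarith [fourthMoment_diag_eq δ β i j]

lemma sum_fourthMoment {δ β : ℝ} (hδ : 0 < δ) (hβ : β < n + 2) [Nonempty (Fin n)] :
    ∑ i : Fin n, ∑ j : Fin n, fourthMoment δ β i i j j =
      n * volume.real (Metric.ball (0 : EuclideanSpace ℝ (Fin n)) 1) *
        (δ ^ ((n : ℝ) + 2 - β) / (n + 2 - β)) := by
  have hI := integrableOn_fourthMoment hβ δ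
  have h := setIntegral_ball_norm_rpow (E := EuclideanSpace ℝ (Fin n)) (q := 2 - β) (r := δ)
    (by rw [finrank_euclideanSpace_fin]; linarith) hδ
  rw [finrank_euclideanSpace_fin, ← add_sub_assoc] at h
  rw [← h]
  unfold fourthMoment
  simp only [← integral_finsetSum _ fun j _ ↦ hI _ _ j j]
  rw [← integral_finsetSum _ fun i _ ↦ integrable_finsetSum _ fun j _ ↦ hI i i j j]
  refine integral_congr_ae (Filter.Eventually.filter_mono (ae_mono Measure.restrict_le_self) ?_)
  filter_upwards [compl_mem_ae_iff.mpr (measure_singleton (0 : EuclideanSpace ℝ (Fin n)))]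
    with w hw
  rw [← norm_pow_four_div_rpow hw, show 4 = 2 * 2 from rfl, pow_mul,
    EuclideanSpace.real_norm_sq_eq, sq (∑ i, _), Finset.sum_mul_sum, Finset.sum_div]
  refine Finset.sum_congr rfl fun i _ ↦ ?_
  rw [Finset.sum_div]
  refine Finset.sum_congr rfl fun j _ ↦ ?_
  ring

lemma fourthMoment_diag {δ β : ℝ} (hδ : 0 < δ) (hβ : β < n + 2) (i : Fin n) :
    ((n : ℝ) + 2) * cdb n δ β * fourthMoment δ β i i i i = 6 := by
  have : Nonempty (Fin n) := ⟨i⟩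
  have hn : (0 : ℝ) < n := by exact_mod_cast Fin.pos i
  have hsum := sum_fourthMoment hδ hβ (n := n)
  generalize hI : fourthMoment δ β i i i i = I
  have hterm (a b : Fin n) : fourthMoment δ β a a b b =
      I / 3 + if a = b then 2 * I / 3 else 0 := by
    split_ifs with hab
    · rw [← hab, fourthMoment_diag_eq δ β a i, hI]
      ring
    · rw [← hI, fourthMoment_diag_eq δ β i a, fourthMoment_diag_eq_three_mul hβ δ hab]
      ring
  have hball : volume.real (Metric.ball (0 : EuclideanSpace ℝ (Fin n)) 1) =
      Real.pi ^ ((n : ℝ) / 2) / Real.Gamma ((n : ℝ) / 2 + 1) := by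
    rw [measureReal_def, EuclideanSpace.volume_ball, ENNReal.ofReal_one, one_pow, one_mul,
      Fintype.card_fin, ENNReal.toReal_ofReal (by positivity), Real.sqrt_eq_rpow,
      ← Real.rpow_mul_natCast Real.pi_pos.le]
    congr 2
    ring
  simp only [hterm, hball, Finset.sum_add_distrib, Finset.sum_const, Finset.card_univ,
    Fintype.card_fin, Finset.sum_ite_eq, Finset.mem_univ, if_true, nsmul_eq_mul] at hsum
  have hG : 0 < Real.Gamma ((n : ℝ) / 2 + 1) := Real.Gamma_pos_of_pos (by positivity)
  have hP : 0 < Real.pi ^ ((n : ℝ) / 2) := by positivity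
  have hD : 0 < δ ^ ((n : ℝ) + 2 - β) := by positivity
  have hB : (0 : ℝ) < n + 2 - β := by linarith
  unfold cdb
  generalize Real.Gamma ((n : ℝ) / 2 + 1) = G at *
  generalize Real.pi ^ ((n : ℝ) / 2) = P at *
  generalize δ ^ ((n : ℝ) + 2 - β) = D at *
  generalize (n : ℝ) + 2 - β = B at *
  have hval : I = 3 * P * D / (G * B * (n + 2)) := by
    field_simp at hsum ⊢
    linarith
  rw [hval]
  field_simp
  ring

lemma fourthMoment_pair {δ β : ℝ} (hδ : 0 < δ) (hβ : β < n + 2) {i j : Fin n} (hij : i ≠ j) :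
    ((n : ℝ) + 2) * cdb n δ β * fourthMoment δ β i i j j = 2 := by
  have h := fourthMoment_diag hδ hβ i
  rw [fourthMoment_diag_eq_three_mul hβ δ hij] at h
  linarith

lemma fourthMoment_swap_left (δ β : ℝ) (i j k l : Fin n) :
    fourthMoment δ β i j k l = fourthMoment δ β j i k l := by
  unfold fourthMoment
  congr 1 with w
  ring

lemma fourthMoment_swap_middle (δ β : ℝ) (i j k l : Fin n) :
    fourthMoment δ β i j k l = fourthMoment δ β i k j l := by
  unfold fourthMoment
  congr 1 with w
  ring

lemma fourthMoment_swap_right (δ β : ℝ) (i j k l : Fin n) :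
    fourthMoment δ β i j k l = fourthMoment δ β i j l k := by
  unfold fourthMoment
  congr 1 with w
  ring

end FourthMoment

/-- The fourth-moment integrals of the peridynamic kernel over the ball. -/
theorem stmt1 (n : ℕ) (hn : 1 ≤ n) (δ β : ℝ) (hδ : 0 < δ) (hβ : β < n + 2)
    (i j k l : Fin n) :
    (((i = j ∧ j = k ∧ k = l) →
      ((n : ℝ) + 2) * cdb n δ β *
        ∫ w in Metric.ball (0 : EuclideanSpace ℝ (Fin n)) δ,
          w i * w j * w k * w l / ‖w‖ ^ (β + 2) = 6) ∧
    (((i = j ∧ k = l ∧ i ≠ k) ∨ (i = k ∧ j = l ∧ i ≠ j) ∨ (i = l ∧ j = k ∧ i ≠ j)) →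
      ((n : ℝ) + 2) * cdb n δ β *
        ∫ w in Metric.ball (0 : EuclideanSpace ℝ (Fin n)) δ,
          w i * w j * w k * w l / ‖w‖ ^ (β + 2) = 2) ∧
    ((¬ (i = j ∧ j = k ∧ k = l) ∧
      ¬ ((i = j ∧ k = l ∧ i ≠ k) ∨ (i = k ∧ j = l ∧ i ≠ j) ∨ (i = l ∧ j = k ∧ i ≠ j))) →
      ((n : ℝ) + 2) * cdb n δ β *
        ∫ w in Metric.ball (0 : EuclideanSpace ℝ (Fin n)) δ,
          w i * w j * w k * w l / ‖w‖ ^ (β + 2) = 0)) := by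
  simp only [← fourthMoment.eq_def]
  refine ⟨?_, ?_, ?_⟩
  · rintro ⟨rfl, rfl, rfl⟩
    exact fourthMoment_diag hδ hβ i
  · rintro (⟨rfl, rfl, h⟩ | ⟨rfl, rfl, h⟩ | ⟨rfl, rfl, h⟩)
    · exact fourthMoment_pair hδ hβ h
    · rw [fourthMoment_swap_middle]
      exact fourthMoment_pair hδ hβ h
    · rw [fourthMoment_swap_right, fourthMoment_swap_middle]
      exact fourthMoment_pair hδ hβ h
  · intro h
    have hsingle : (j ≠ i ∧ k ≠ i ∧ l ≠ i) ∨ (i ≠ j ∧ k ≠ j ∧ l ≠ j) ∨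
        (i ≠ k ∧ j ≠ k ∧ l ≠ k) ∨ (i ≠ l ∧ j ≠ l ∧ k ≠ l) := by
      grind
    obtain ⟨h1, h2, h3⟩ | ⟨h1, h2, h3⟩ | ⟨h1, h2, h3⟩ | ⟨h1, h2, h3⟩ := hsingle
    · rw [fourthMoment_eq_zero δ β h1 h2 h3, mul_zero]
    · rw [fourthMoment_swap_left, fourthMoment_eq_zero δ β h1 h2 h3, mul_zero]
    · rw [fourthMoment_swap_middle, fourthMoment_swap_left, fourthMoment_eq_zero δ β h1 h2 h3,
        mul_zero]
    · rw [fourthMoment_swap_right, fourthMoment_swap_middle, fourthMoment_swap_left,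
        fourthMoment_eq_zero δ β h1 h2 h3, mul_zero]
end

section
/- Let φ(t) = ₂F₃(1, a; 2, b, a+1; −z²) with a = (n+2−β)/2, b = (n+4)/2 and z = δ‖ν‖/2. If β < n (so a > 1), then as ‖ν‖ → ∞, −μ‖ν‖² φ converges to the finite limit −μ·2(n+2−β)(n+2)/(δ²(n−β)); in particular, λ₂(ν) = −μ‖ν‖² ₂F₃(1,(n+2−β)/2; 2,(n+4)/2,(n+4−β)/2; −δ²‖ν‖²/4) is bounded as ‖ν‖ → ∞. -/
open Filter

/-- The generalized hypergeometric function `pFq` with real parameter lists. -/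
noncomputable def hypergeom (a b : List ℝ) (x : ℝ) : ℝ :=
  ∑' m : ℕ,
    ((a.map fun t => (ascPochhammer ℝ m).eval t).prod /
      (b.map fun t => (ascPochhammer ℝ m).eval t).prod) * x ^ m / (m.factorial : ℝ)

/-- The exponential generating function of a real sequence. -/
noncomputable def expGenFun (d : ℕ → ℝ) (x : ℝ) : ℝ :=
  ∑' k : ℕ, d k * x ^ k / (k.factorial : ℝ)

theorem summable_expGenFun {d : ℕ → ℝ} {M : ℝ} (hd : ∀ k, |d k| ≤ M) (x : ℝ) :
    Summable fun k : ℕ => d k * x ^ k / (k.factorial : ℝ) := by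
  refine Summable.of_norm_bounded ((Real.summable_pow_div_factorial |x|).mul_left M) fun k => ?_
  rw [Real.norm_eq_abs, abs_div, abs_mul, abs_pow, Nat.abs_cast, mul_div_assoc]
  gcongr
  exact hd k

theorem succ_mul_pow_div_factorial (t x : ℝ) (k : ℕ) :
    t * (((k + 1 : ℕ) : ℝ) * x) / ((k + 1).factorial : ℝ) = t * x / (k.factorial : ℝ) := by
  rw [Nat.factorial_succ]
  push_cast
  field_simp

theorem hasDerivAt_expGenFun {d : ℕ → ℝ} {M : ℝ} (hd : ∀ k, |d k| ≤ M) (x : ℝ) :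
    HasDerivAt (expGenFun d) (expGenFun (fun k => d (k + 1)) x) x := by
  set r : ℝ := |x| + 1
  have hsum : ∀ (e : ℕ → ℝ) (y : ℝ), (Summable fun k : ℕ => e (k + 1) * y ^ k / (k.factorial : ℝ)) →
      Summable fun k : ℕ => e k * ((k : ℝ) * y ^ (k - 1)) / (k.factorial : ℝ) := by
    intro e y h
    rw [← summable_nat_add_iff 1]
    refine h.congr fun k => ?_
    exact (succ_mul_pow_div_factorial (e (k + 1)) (y ^ k) k).symm
  have hu := hsum (fun _ => M) r (summable_expGenFun (M := |M|) (fun _ => le_rfl) r)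
  have key := hasDerivAt_tsum_of_isPreconnected hu (Metric.isOpen_ball (x := (0 : ℝ)) (ε := r))
    (convex_ball (0 : ℝ) r).isPreconnected
    (g := fun k y => d k * y ^ k / (k.factorial : ℝ))
    (g' := fun k y => d k * ((k : ℝ) * y ^ (k - 1)) / (k.factorial : ℝ))
    (fun k y _ => ((hasDerivAt_pow k y).const_mul (d k)).div_const _)
    (fun k y hy => by
      have hy' : |y| ≤ r := by simpa using (mem_ball_zero_iff.1 hy).le
      rw [Real.norm_eq_abs, abs_div, abs_mul, abs_mul, abs_pow, Nat.abs_cast, Nat.abs_cast]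
      have hM : 0 ≤ M := (abs_nonneg _).trans (hd k)
      gcongr
      exact hd k)
    (y₀ := x) (by simp [r]) (summable_expGenFun hd x) (y := x) (by simp [r])
  convert! key using 1
  rw [(hsum d x (summable_expGenFun (fun k => hd (k + 1)) x)).tsum_eq_zero_add]
  simp only [Nat.cast_zero, zero_mul, mul_zero, zero_div, zero_add]
  exact tsum_congr fun k => (succ_mul_pow_div_factorial (d (k + 1)) (x ^ k) k).symm

theorem mul_expGenFun_succ {d : ℕ → ℝ} {M : ℝ} (hd : ∀ k : ℕ, |(k : ℝ) * d k| ≤ M) (x : ℝ) :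
    x * expGenFun (fun k => d (k + 1)) x = expGenFun (fun k => (k : ℝ) * d k) x := by
  unfold expGenFun
  rw [(summable_expGenFun hd x).tsum_eq_zero_add, ← tsum_mul_left]
  simp only [Nat.cast_zero, zero_mul, zero_div, zero_add]
  refine tsum_congr fun k => ?_
  have := succ_mul_pow_div_factorial (d (k + 1)) (x ^ (k + 1)) k
  rw [show ((k + 1 : ℕ) : ℝ) * d (k + 1) * x ^ (k + 1) / ((k + 1).factorial : ℝ)
    = d (k + 1) * x ^ (k + 1) / (k.factorial : ℝ) by rw [← this]; ring]
  ring

theorem expGenFun_add_const_mul {d e : ℕ → ℝ} {M N : ℝ} (hd : ∀ k, |d k| ≤ M)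
    (he : ∀ k, |e k| ≤ N) (t x : ℝ) :
    expGenFun (fun k => d k + t * e k) x = expGenFun d x + t * expGenFun e x := by
  unfold expGenFun
  rw [← tsum_mul_left,
    ← (summable_expGenFun hd x).tsum_add ((summable_expGenFun he x).mul_left t)]
  exact tsum_congr fun k => by ring

/-- An energy estimate for solutions of `x F'' + c F' + F = 0`. -/
theorem exists_bound_of_bessel_ode {F F' : ℝ → ℝ} {c : ℝ} (hc : 1 / 2 ≤ c)
    (hF : ∀ x, HasDerivAt F (F' x) x)
    (hW : ∀ x, HasDerivAt (fun y => y * F' y) (-(c - 1) * F' x - F x) x) :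
    ∃ K, ∀ x, 1 ≤ x → |x * F' x + (c - 1) * F x| ≤ K * Real.sqrt x := by
  set E : ℝ → ℝ := fun x => (x * F' x) ^ 2 / x + F x ^ 2
  have hEd : ∀ x, 1 ≤ x → HasDerivAt E ((1 - 2 * c) * F' x ^ 2) x := by
    intro x hx
    have hx0 : x ≠ 0 := by positivity
    convert! (((hW x).pow 2).div (hasDerivAt_id x) hx0).add ((hF x).pow 2) using 1
    simp only [id, Pi.pow_apply]
    field_simp
    push_cast
    ring
  have hanti : AntitoneOn E (Set.Ici 1) := by
    refine antitoneOn_of_deriv_nonpos (convex_Ici 1)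
      (fun x hx => (hEd x hx).continuousAt.continuousWithinAt)
      (fun x hx => (hEd x (interior_subset hx)).differentiableAt.differentiableWithinAt)
      fun x hx => ?_
    rw [(hEd x (interior_subset hx)).deriv]
    exact mul_nonpos_of_nonpos_of_nonneg (by linarith) (sq_nonneg _)
  refine ⟨Real.sqrt (E 1) * (1 + |c - 1|), fun x hx => ?_⟩
  have hx0 : 0 < x := by positivity
  have hle : (x * F' x) ^ 2 / x + F x ^ 2 ≤ E 1 := hanti Set.self_mem_Ici hx hx
  have h1 : |x * F' x| ≤ Real.sqrt (E 1) * Real.sqrt x := by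
    rw [← Real.sqrt_mul' _ hx0.le]
    apply Real.abs_le_sqrt
    rw [← div_le_iff₀ hx0]
    linarith [sq_nonneg (F x)]
  have h2 : |F x| ≤ Real.sqrt (E 1) := by
    apply Real.abs_le_sqrt
    have : 0 ≤ (x * F' x) ^ 2 / x := by positivity
    linarith
  have h3 : 1 ≤ Real.sqrt x := Real.one_le_sqrt.2 hx
  calc |x * F' x + (c - 1) * F x| ≤ |x * F' x| + |c - 1| * |F x| := by
        rw [← abs_mul]; exact abs_add_le _ _
    _ ≤ Real.sqrt (E 1) * Real.sqrt x + |c - 1| * (Real.sqrt (E 1) * Real.sqrt x) := by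
        gcongr
        exact h2.trans (le_mul_of_one_le_right (Real.sqrt_nonneg _) h3)
    _ = _ := by ring

theorem tendsto_div_rpow_of_abs_deriv_le {h h' : ℝ → ℝ} {C p s : ℝ} (hp : 0 < p) (hps : p < s)
    (hd : ∀ x, 1 ≤ x → HasDerivAt h (h' x) x) (hb : ∀ x, 1 ≤ x → |h' x| ≤ C * x ^ (p - 1)) :
    Tendsto (fun x => h x / x ^ s) atTop (nhds 0) := by
  have hC : 0 ≤ C := by simpa using (abs_nonneg _).trans (hb 1 le_rfl)
  have hB : ∀ x, 1 ≤ x → |h x| ≤ |h 1| + C / p * x ^ p := by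
    intro x hx
    refine image_norm_le_of_norm_deriv_right_le_deriv_boundary' (f := h) (f' := h') (a := 1) (b := x)
      (B := fun y => |h 1| + C / p * y ^ p) (B' := fun y => C * y ^ (p - 1))
      (fun y hy => (hd y hy.1).continuousAt.continuousWithinAt)
      (fun y hy => (hd y hy.1).hasDerivWithinAt) ?_ ?_ ?_ (fun y hy => hb y hy.1) ⟨hx, le_rfl⟩
    · simp only [Real.norm_eq_abs, Real.one_rpow, mul_one]
      linarith [div_nonneg hC hp.le]
    · exact fun y hy => (continuousAt_const.add (continuousAt_const.mul
        (Real.continuousAt_rpow_const y p (Or.inr hp.le)))).continuousWithinAt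
    · intro y hy
      have hy0 : y ≠ 0 := by linarith [hy.1]
      convert! (((Real.hasDerivAt_rpow_const (p := p) (Or.inl hy0)).const_mul (C / p)).const_add
        |h 1|).hasDerivWithinAt using 1
      field_simp
  have hlim : Tendsto (fun x : ℝ => |h 1| * x ^ (-s) + C / p * x ^ (-(s - p))) atTop (nhds 0) := by
    simpa using ((tendsto_rpow_neg_atTop (hp.trans hps)).const_mul |h 1|).add
      ((tendsto_rpow_neg_atTop (sub_pos.2 hps)).const_mul (C / p))
  refine squeeze_zero_norm' ?_ hlim
  filter_upwards [eventually_ge_atTop 1] with x hx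
  have hx0 : 0 < x := by positivity
  have hs : 0 < x ^ s := Real.rpow_pos_of_pos hx0 s
  rw [Real.norm_eq_abs, abs_div, abs_of_pos hs, div_le_iff₀ hs]
  refine (hB x hx).trans_eq ?_
  rw [add_mul, mul_assoc, mul_assoc, ← Real.rpow_add hx0, ← Real.rpow_add hx0]
  simp

/-- If `x G' + s G = F` and `F` is minus the derivative of a function `P = O(√x)`, then `G → 0`. -/
theorem tendsto_zero_of_euler_ode {F G G' P : ℝ → ℝ} {s K : ℝ} (hs : 0 < s)
    (hG : ∀ x, HasDerivAt G (G' x) x) (hGF : ∀ x, x * G' x + s * G x = F x)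
    (hP : ∀ x, HasDerivAt P (-F x) x) (hPK : ∀ x, 1 ≤ x → |P x| ≤ K * Real.sqrt x) :
    Tendsto G atTop (nhds 0) := by
  have hK : 0 ≤ K := by simpa using (abs_nonneg _).trans (hPK 1 le_rfl)
  set ε : ℝ := min (1 / 2) (s / 2)
  have hε0 : 0 < ε := by positivity
  have hε1 : ε ≤ 1 / 2 := min_le_left _ _
  have hεs : ε ≤ s / 2 := min_le_right _ _
  have hPx : ∀ x, 1 ≤ x → |P x / x| ≤ K * x ^ (-ε) := by
    intro x hx
    have hx0 : 0 < x := by positivity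
    rw [abs_div, abs_of_pos hx0, div_le_iff₀ hx0]
    refine (hPK x hx).trans ?_
    rw [mul_assoc, ← Real.rpow_add_one hx0.ne', Real.sqrt_eq_rpow]
    gcongr
    linarith
  have hQ : Tendsto (fun x => x ^ s * (G x + P x / x) / x ^ s) atTop (nhds 0) := by
    refine tendsto_div_rpow_of_abs_deriv_le (C := |s - 1| * K) (p := s - ε)
      (h' := fun x => (s - 1) * (P x / x) * x ^ (s - 1)) (by linarith) (by linarith) ?_ ?_
    · intro x hx
      have hx0 : 0 < x := by positivity
      convert! (Real.hasDerivAt_rpow_const (p := s) (Or.inl hx0.ne')).mul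
        ((hG x).add ((hP x).div (hasDerivAt_id x) hx0.ne')) using 1
      simp only [id, Pi.add_apply, Pi.div_apply]
      rw [show x ^ s = x ^ (s - 1) * x by rw [← Real.rpow_add_one hx0.ne']; simp, ← hGF x]
      field_simp
      ring
    · intro x hx
      have hx0 : 0 < x := by positivity
      rw [abs_mul, abs_mul, abs_of_pos (Real.rpow_pos_of_pos hx0 _)]
      calc |s - 1| * |P x / x| * x ^ (s - 1) ≤ |s - 1| * (K * x ^ (-ε)) * x ^ (s - 1) := by
            gcongr
            exact hPx x hx
        _ = |s - 1| * K * (x ^ (-ε) * x ^ (s - 1)) := by ring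
        _ = _ := by rw [← Real.rpow_add hx0]; ring_nf
  have hP0 : Tendsto (fun x => P x / x) atTop (nhds 0) := by
    refine squeeze_zero_norm' ?_ (by simpa using (tendsto_rpow_neg_atTop hε0).const_mul K)
    filter_upwards [eventually_ge_atTop 1] with x hx using hPx x hx
  have := hQ.sub hP0
  rw [sub_zero] at this
  refine this.congr' ?_
  filter_upwards [eventually_gt_atTop 0] with x hx
  rw [mul_div_cancel_left₀ _ (Real.rpow_pos_of_pos hx s).ne', add_sub_cancel_right]

/-- The coefficients `(-1)ᵏ / (c)ₖ` of `₀F₁(; c; -x)` as an exponential generating function. -/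
noncomputable def besselCoeff (c : ℝ) (k : ℕ) : ℝ :=
  (-1) ^ k / (ascPochhammer ℝ k).eval c

theorem besselCoeff_succ {c : ℝ} (hc : 0 < c) (k : ℕ) :
    (c + k) * besselCoeff c (k + 1) = -besselCoeff c k := by
  have := ascPochhammer_pos k c hc
  have : 0 < c + k := by positivity
  rw [besselCoeff, besselCoeff, ascPochhammer_succ_eval, pow_succ]
  field_simp

theorem abs_besselCoeff_succ {c : ℝ} (hc : 0 < c) (k : ℕ) :
    (c + k) * |besselCoeff c (k + 1)| = |besselCoeff c k| := by
  have h := congrArg abs (besselCoeff_succ hc k)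
  rwa [abs_mul, abs_neg, abs_of_pos (by positivity : 0 < c + k)] at h

theorem abs_besselCoeff_le_one {c : ℝ} (hc : 1 ≤ c) (k : ℕ) : |besselCoeff c k| ≤ 1 := by
  induction k with
  | zero => simp [besselCoeff]
  | succ k ih =>
    rw [← abs_besselCoeff_succ (by linarith)] at ih
    exact (le_mul_of_one_le_left (abs_nonneg _) (le_add_of_le_of_nonneg hc k.cast_nonneg)).trans ih

theorem abs_mul_besselCoeff_le_one {c : ℝ} (hc : 1 ≤ c) (k : ℕ) :
    |(k : ℝ) * besselCoeff c k| ≤ 1 := by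
  cases k with
  | zero => simp
  | succ k =>
    have h := abs_besselCoeff_le_one hc k
    rw [← abs_besselCoeff_succ (by linarith)] at h
    refine le_trans ?_ h
    rw [abs_mul, Nat.abs_cast]
    gcongr
    push_cast
    linarith

theorem tendsto_expGenFun_besselCoeff_div {c s : ℝ} (hc : 1 ≤ c) (hs : 0 < s) :
    Tendsto (expGenFun fun k => besselCoeff c k / (s + k)) atTop (nhds 0) := by
  have hb := abs_besselCoeff_le_one hc
  have hkb := abs_mul_besselCoeff_le_one hc
  have hbs : ∀ k, |besselCoeff c (k + 1)| ≤ 1 := fun k => hb (k + 1)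
  set F := expGenFun (besselCoeff c)
  set F' := expGenFun fun k => besselCoeff c (k + 1)
  have hF : ∀ x, HasDerivAt F (F' x) x := hasDerivAt_expGenFun hb
  have hW : ∀ x, HasDerivAt (fun y => y * F' y) (-(c - 1) * F' x - F x) x := by
    intro x
    convert! hasDerivAt_expGenFun hkb x using 1
    · exact funext (mul_expGenFun_succ hkb)
    · have hcoef : (fun k : ℕ => ((k + 1 : ℕ) : ℝ) * besselCoeff c (k + 1)) =
          fun k => (-(c - 1) * besselCoeff c (k + 1)) + (-1) * besselCoeff c k := by
        funext k
        push_cast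
        linarith [besselCoeff_succ (by linarith : 0 < c) k]
      have h0 : expGenFun (fun k => -(c - 1) * besselCoeff c (k + 1)) x = -(c - 1) * F' x := by
        simp only [F', expGenFun, ← tsum_mul_left]
        exact tsum_congr fun k => by ring
      rw [hcoef, expGenFun_add_const_mul (M := |-(c - 1)|) (fun k => ?_) hb, h0]
      · ring
      · rw [abs_mul]
        exact mul_le_of_le_one_right (abs_nonneg _) (hbs k)
  obtain ⟨K, hK⟩ := exists_bound_of_bessel_ode (by linarith) hF hW
  have hpos : ∀ k : ℕ, 0 < s + k := fun k => by positivity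
  have hg : ∀ k : ℕ, |besselCoeff c k / (s + k)| ≤ 1 / s := by
    intro k
    rw [abs_div, abs_of_pos (hpos k)]
    exact div_le_div₀ zero_le_one (hb k) hs (le_add_of_nonneg_right k.cast_nonneg)
  have hkg : ∀ k : ℕ, |(k : ℝ) * (besselCoeff c k / (s + k))| ≤ 1 := by
    intro k
    rw [← mul_div_assoc, abs_div, abs_of_pos (hpos k), div_le_one (hpos k), abs_mul, Nat.abs_cast]
    exact (mul_le_of_le_one_right k.cast_nonneg (hb k)).trans (le_add_of_nonneg_left hs.le)
  refine tendsto_zero_of_euler_ode (F := F) (P := fun x => x * F' x + (c - 1) * F x) hs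
    (hasDerivAt_expGenFun hg) (fun x => ?_) (fun x => ?_) hK
  · rw [mul_expGenFun_succ (d := fun k => besselCoeff c k / (s + k)) hkg,
      ← expGenFun_add_const_mul hkg hg]
    congr 1
    funext k
    have := (hpos k).ne'
    field_simp
    ring
  · convert! (hW x).add ((hF x).const_mul (c - 1)) using 1
    ring

theorem ascPochhammer_succ_eval_left (k : ℕ) (x : ℝ) :
    (ascPochhammer ℝ (k + 1)).eval x = x * (ascPochhammer ℝ k).eval (x + 1) := by
  simp [ascPochhammer_succ_left]

theorem mul_hypergeom_eq {s c : ℝ} (hs : 0 < s) (hc : 1 ≤ c) (x : ℝ) :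
    x * hypergeom [1, s + 1] [2, c + 1, s + 2] (-x) =
      (s + 1) * c * (1 / s - expGenFun (fun k => besselCoeff c k / (s + k)) x) := by
  have hg : ∀ k : ℕ, |besselCoeff c k / (s + k)| ≤ 1 / s := by
    intro k
    rw [abs_div, abs_of_pos (by positivity : 0 < s + k)]
    exact div_le_div₀ zero_le_one (abs_besselCoeff_le_one hc k) hs
      (le_add_of_nonneg_right k.cast_nonneg)
  have h0 : expGenFun (fun k => besselCoeff c k / (s + k)) x = 1 / s +
      ∑' k : ℕ, besselCoeff c (k + 1) / (s + (k + 1 : ℕ)) * x ^ (k + 1) /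
        ((k + 1).factorial : ℝ) := by
    rw [expGenFun, (summable_expGenFun hg x).tsum_eq_zero_add]
    simp [besselCoeff]
  rw [h0, sub_add_cancel_left, ← tsum_neg, hypergeom, ← tsum_mul_left, ← tsum_mul_left]
  refine tsum_congr fun k => ?_
  have h1 : (ascPochhammer ℝ k).eval 1 = (k.factorial : ℝ) := ascPochhammer_eval_one ℝ k
  have h2 : (ascPochhammer ℝ k).eval 2 = ((k + 1).factorial : ℝ) := by
    rw [← ascPochhammer_eval_one ℝ (k + 1), ascPochhammer_succ_eval_left]
    norm_num
  have h3 : (s + 1) * (ascPochhammer ℝ k).eval (s + 2) =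
      (ascPochhammer ℝ k).eval (s + 1) * (s + 1 + k) := by
    rw [← ascPochhammer_succ_eval, ascPochhammer_succ_eval_left]
    ring_nf
  have p1 := ascPochhammer_pos k (s + 1) (by linarith)
  have p2 := ascPochhammer_pos k (s + 2) (by linarith)
  have p3 := ascPochhammer_pos k (c + 1) (by linarith)
  have p4 : 0 < s + 1 + k := by positivity
  have h4 : (ascPochhammer ℝ k).eval (s + 1) =
      (s + 1) * (ascPochhammer ℝ k).eval (s + 2) / (s + 1 + k) := by
    rw [h3]; field_simp
  simp only [List.map_cons, List.map_nil, List.prod_cons, List.prod_nil, mul_one]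
  rw [besselCoeff, ascPochhammer_succ_eval_left, h1, h2, h4, neg_pow x k]
  push_cast
  rw [show s + ((k : ℝ) + 1) = s + 1 + k by ring]
  field_simp
  ring

/-- For `β < n`, the transverse eigenvalue
`λ₂(ν) = -μ‖ν‖² ₂F₃(1,(n+2-β)/2; 2,(n+4)/2,(n+4-β)/2; -δ²‖ν‖²/4)`
converges to `-μ·2(n+2-β)(n+2)/(δ²(n-β))` as `‖ν‖ → ∞`; in particular it is
eventually bounded. -/
theorem stmt12 (n : ℕ) (hn : 1 ≤ n) (δ β μ : ℝ) (hδ : 0 < δ) (hμ : 0 < μ)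
    (hβ : β < n) :
    Tendsto
      (fun R : ℝ => -μ * R ^ 2 *
        hypergeom [1, ((n : ℝ) + 2 - β) / 2]
          [2, ((n : ℝ) + 4) / 2, ((n : ℝ) + 4 - β) / 2] (-(δ ^ 2 * R ^ 2 / 4)))
      atTop
      (nhds (-μ * (2 * ((n : ℝ) + 2 - β) * ((n : ℝ) + 2)) / (δ ^ 2 * ((n : ℝ) - β)))) ∧
    ∃ B : ℝ, ∀ᶠ R : ℝ in atTop,
      |(-μ * R ^ 2 *
        hypergeom [1, ((n : ℝ) + 2 - β) / 2]
          [2, ((n : ℝ) + 4) / 2, ((n : ℝ) + 4 - β) / 2] (-(δ ^ 2 * R ^ 2 / 4)))| ≤ B := by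
  suffices h : Tendsto
      (fun R : ℝ => -μ * R ^ 2 *
        hypergeom [1, ((n : ℝ) + 2 - β) / 2]
          [2, ((n : ℝ) + 4) / 2, ((n : ℝ) + 4 - β) / 2] (-(δ ^ 2 * R ^ 2 / 4)))
      atTop
      (nhds (-μ * (2 * ((n : ℝ) + 2 - β) * ((n : ℝ) + 2)) / (δ ^ 2 * ((n : ℝ) - β)))) by
    obtain ⟨B, hB⟩ := h.abs.isBoundedUnder_le
    exact ⟨h, B, eventually_map.1 hB⟩
  obtain ⟨s, hs⟩ : ∃ s : ℝ, s = ((n : ℝ) - β) / 2 := ⟨_, rfl⟩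
  obtain ⟨c, hc⟩ : ∃ c : ℝ, c = ((n : ℝ) + 2) / 2 := ⟨_, rfl⟩
  have hs0 : 0 < s := by rw [hs]; linarith
  have hc1 : 1 ≤ c := by rw [hc]; linarith [(n.cast_nonneg : (0 : ℝ) ≤ n)]
  rw [show ((n : ℝ) + 2 - β) / 2 = s + 1 by rw [hs]; ring,
    show ((n : ℝ) + 4) / 2 = c + 1 by rw [hc]; ring,
    show ((n : ℝ) + 4 - β) / 2 = s + 2 by rw [hs]; ring,
    show (n : ℝ) + 2 - β = 2 * (s + 1) by rw [hs]; ring,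
    show (n : ℝ) + 2 = 2 * c by rw [hc]; ring,
    show (n : ℝ) - β = 2 * s by rw [hs]; ring]
  have hx : Tendsto (fun R : ℝ => δ ^ 2 * R ^ 2 / 4) atTop atTop :=
    ((tendsto_pow_atTop two_ne_zero).const_mul_atTop (by positivity)).atTop_div_const (by norm_num)
  have hlim := ((((tendsto_expGenFun_besselCoeff_div hc1 hs0).comp hx).const_sub
    (1 / s)).const_mul ((s + 1) * c)).const_mul (-μ * 4 / δ ^ 2)
  refine (hlim.congr fun R => ?_).trans_eq ?_
  · rw [Function.comp_apply, ← mul_hypergeom_eq hs0 hc1]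
    field_simp
  · congr 1
    field_simp
    ring
end
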